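/- arXiv:2410.11066 — 5 statements merged into one kernel-verified Lean document; each statement's English description precedes it below -/
import Mathlib

section
/- For every integer k ≥ 1, min_{1≤j≤k} η_j ≤ (α_0 − (1+σ)^k α_k) / (Σ_{j=1}^k (1+σ)^{j−1} γ_j) + δ. -/
/-- Telescoping a geometrically weighted one-step descent inequality. -/
theorem sum_Icc_pow_mul_le_sub_pow_mul {c α : ℕ → ℝ} {r : ℝ} (hr : 0 ≤ r)
    (h : ∀ j : ℕ, 1 ≤ j → c j ≤ α (j - 1) - r * α j) (k : ℕ) :
    ∑ j ∈ Finset.Icc 1 k, r ^ (j - 1) * c j ≤ α 0 - r ^ k * α k := by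
  induction k with
  | zero => simp
  | succ k ih =>
    rw [Finset.sum_Icc_succ_top (by lia)]
    have hstep := mul_le_mul_of_nonneg_left (h (k + 1) (by lia)) (pow_nonneg hr k)
    simp only [Nat.add_sub_cancel] at hstep ⊢
    rw [pow_succ]
    linarith

/-- Lemma A.1(a) of the paper: given sequences {γ_j}, {η_j}, {α_j} with
γ_j ≥ γ̲ > 0 and γ_j η_j ≤ α_{j-1} - (1+σ) α_j + γ_j δ for all j ≥ 1,
for every k ≥ 1 we have
min_{1≤j≤k} η_j ≤ (α_0 - (1+σ)^k α_k) / (Σ_{j=1}^k (1+σ)^{j-1} γ_j) + δ. -/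
theorem stmt_0 (γ η α : ℕ → ℝ) (σ δ γlow : ℝ)
    (hσ : 0 ≤ σ) (hδ : 0 ≤ δ) (hγlow : 0 < γlow)
    (hγ : ∀ j : ℕ, 1 ≤ j → γlow ≤ γ j)
    (hrec : ∀ j : ℕ, 1 ≤ j →
      γ j * η j ≤ α (j - 1) - (1 + σ) * α j + γ j * δ)
    (k : ℕ) (hk : 1 ≤ k) :
    (Finset.Icc 1 k).inf' (Finset.nonempty_Icc.mpr hk) η ≤
      (α 0 - (1 + σ) ^ k * α k) /
        (∑ j ∈ Finset.Icc 1 k, (1 + σ) ^ (j - 1) * γ j) + δ := by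
  have hpos : ∀ j ∈ Finset.Icc 1 k, 0 < (1 + σ) ^ (j - 1) * γ j := fun j hj =>
    mul_pos (by positivity) (hγlow.trans_le (hγ j (Finset.mem_Icc.mp hj).1))
  have hsum := sum_Icc_pow_mul_le_sub_pow_mul (c := fun j => γ j * (η j - δ)) (α := α)
    (r := 1 + σ) (by positivity) (fun j hj => by linarith [hrec j hj]) k
  rw [← sub_le_iff_le_add,
    le_div_iff₀ (Finset.sum_pos hpos (Finset.nonempty_Icc.mpr hk)), Finset.mul_sum]
  refine (Finset.sum_le_sum fun j hj => ?_).trans hsum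
  have hmin := mul_le_mul_of_nonneg_left
    (sub_le_sub_right (Finset.inf'_le η hj) δ) (hpos j hj).le
  linarith
end

section
/- If in addition σ > 0, δ > 0, and α_j ≥ 0 for all j ≥ 0, then min_{1≤j≤k} η_j ≤ 2δ for every integer k ≥ 1 with k ≥ ((1+σ)/σ) · log(σ α_0 / (γ̲ δ) + 1), where log denotes the natural logarithm. -/
/-- Lemma A.1(c) of the paper (first case, σ > 0): under the recursion
γ_j η_j ≤ α_{j-1} - (1+σ) α_j + γ_j δ with γ_j ≥ γ̲ > 0, if moreover
σ > 0, δ > 0 and α_j ≥ 0 for all j ≥ 0, then min_{1≤j≤k} η_j ≤ 2δ for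
every integer k ≥ 1 with k ≥ ((1+σ)/σ) log(σ α_0/(γ̲ δ) + 1). -/
theorem stmt_2 (γ η α : ℕ → ℝ) (σ δ γlow : ℝ)
    (hσ : 0 < σ) (hδ : 0 < δ) (hγlow : 0 < γlow)
    (hγ : ∀ j : ℕ, 1 ≤ j → γlow ≤ γ j)
    (hrec : ∀ j : ℕ, 1 ≤ j →
      γ j * η j ≤ α (j - 1) - (1 + σ) * α j + γ j * δ)
    (hα : ∀ j : ℕ, 0 ≤ α j)
    (k : ℕ) (hk : 1 ≤ k)
    (hkbig : ((1 + σ) / σ) * Real.log (σ * α 0 / (γlow * δ) + 1) ≤ (k : ℝ)) :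
    (Finset.Icc 1 k).inf' (Finset.nonempty_Icc.mpr hk) η ≤ 2 * δ := by
  by_contra! hη
  have hη' : ∀ j, 1 ≤ j → j ≤ k → 2 * δ < η j := fun j h₁ h₂ =>
    (Finset.lt_inf'_iff _).mp hη j (Finset.mem_Icc.mpr ⟨h₁, h₂⟩)
  have hc : 0 < γlow * δ := mul_pos hγlow hδ
  have hq : 0 < 1 + σ := by linarith
  have hstep : ∀ j < k, σ * α (j + 1) + γlow * δ < (1 + σ)⁻¹ * (σ * α j + γlow * δ) := by
    intro j hj
    have hr := hrec (j + 1) (Nat.le_add_left 1 j)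
    have hγj := hγ (j + 1) (Nat.le_add_left 1 j)
    rw [Nat.add_sub_cancel] at hr
    have hγη : γ (j + 1) * (2 * δ) < γ (j + 1) * η (j + 1) :=
      mul_lt_mul_of_pos_left (hη' (j + 1) (Nat.le_add_left 1 j) hj) (hγlow.trans_le hγj)
    have hγδ : γlow * δ ≤ γ (j + 1) * δ := mul_le_mul_of_nonneg_right hγj hδ.le
    have hdecr : (1 + σ) * α (j + 1) + γlow * δ < α j := by linarith
    rw [inv_mul_eq_div, lt_div_iff₀ hq]
    nlinarith [mul_lt_mul_of_pos_left hdecr hσ]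
  have hgeom : σ * α k + γlow * δ < (1 + σ)⁻¹ ^ k * (σ * α 0 + γlow * δ) :=
    lt_geom (u := fun j => σ * α j + γlow * δ) (inv_nonneg.mpr hq.le) hk hstep
  have hpow : (1 + σ) ^ k < σ * α 0 / (γlow * δ) + 1 := by
    rw [inv_pow, inv_mul_eq_div, lt_div_iff₀ (pow_pos hq k)] at hgeom
    rw [div_add_one hc.ne', lt_div_iff₀ hc]
    have : 0 ≤ σ * α k * (1 + σ) ^ k :=
      mul_nonneg (mul_nonneg hσ.le (hα k)) (pow_nonneg hq.le k)
    linarith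
  have hlog : k * Real.log (1 + σ) < Real.log (σ * α 0 / (γlow * δ) + 1) := by
    rw [← Real.log_pow]
    exact Real.log_lt_log (pow_pos hq k) hpow
  have hlog_ge : σ / (1 + σ) ≤ Real.log (1 + σ) := by
    have h := Real.one_sub_inv_le_log_of_pos hq
    rwa [show 1 - (1 + σ)⁻¹ = σ / (1 + σ) by field_simp; ring] at h
  have hlt : k * (σ / (1 + σ)) < Real.log (σ * α 0 / (γlow * δ) + 1) :=
    (mul_le_mul_of_nonneg_left hlog_ge k.cast_nonneg).trans_lt hlog
  rw [← inv_div, inv_mul_eq_div, div_le_iff₀ (div_pos hσ hq)] at hkbig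
  exact absurd hlt hkbig.not_gt
end

section
/- If in addition δ > 0 and α_j ≥ 0 for all j ≥ 0, then min_{1≤j≤k} η_j ≤ 2δ for every integer k ≥ 1 with k ≥ α_0 / (γ̲ δ). -/
/-- A sequence that drops by more than `c` at each of its first `k ≥ 1` steps drops by more than
`k * c` in total. -/
theorem add_mul_lt_of_forall_add_lt {α : ℕ → ℝ} {c : ℝ} {k : ℕ} (hk : 1 ≤ k)
    (h : ∀ j < k, α (j + 1) + c < α j) : α k + k * c < α 0 := by
  induction k, hk using Nat.le_induction with
  | base => simpa using h 0 one_pos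
  | succ n _ ih =>
    have hn := ih fun j hj => h j (hj.trans n.lt_succ_self)
    have hlast := h n n.lt_succ_self
    push_cast
    linarith

/-- Lemma A.1(c) of the paper (second case): under the recursion
γ_j η_j ≤ α_{j-1} - (1+σ) α_j + γ_j δ with γ_j ≥ γ̲ > 0 and σ ≥ 0, if
moreover δ > 0 and α_j ≥ 0 for all j ≥ 0, then min_{1≤j≤k} η_j ≤ 2δ for
every integer k ≥ 1 with k ≥ α_0/(γ̲ δ). -/
theorem stmt_3 (γ η α : ℕ → ℝ) (σ δ γlow : ℝ)
    (hσ : 0 ≤ σ) (hδ : 0 < δ) (hγlow : 0 < γlow)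
    (hγ : ∀ j : ℕ, 1 ≤ j → γlow ≤ γ j)
    (hrec : ∀ j : ℕ, 1 ≤ j →
      γ j * η j ≤ α (j - 1) - (1 + σ) * α j + γ j * δ)
    (hα : ∀ j : ℕ, 0 ≤ α j)
    (k : ℕ) (hk : 1 ≤ k)
    (hkbig : α 0 / (γlow * δ) ≤ (k : ℝ)) :
    (Finset.Icc 1 k).inf' (Finset.nonempty_Icc.mpr hk) η ≤ 2 * δ := by
  by_contra! hlt
  rw [Finset.lt_inf'_iff] at hlt
  have hdrop : ∀ j < k, α (j + 1) + γlow * δ < α j := by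
    intro j hj
    have hη := hlt (j + 1) (Finset.mem_Icc.mpr ⟨j.succ_pos, hj⟩)
    have hγj := hγ (j + 1) j.succ_pos
    have hstep := hrec (j + 1) j.succ_pos
    rw [Nat.add_sub_cancel] at hstep
    have hγη := mul_lt_mul_of_pos_left hη (hγlow.trans_le hγj)
    have hγδ := mul_le_mul_of_nonneg_right hγj hδ.le
    have hσα := mul_nonneg hσ (hα (j + 1))
    linarith
  have htotal := add_mul_lt_of_forall_add_lt hk hdrop
  rw [div_le_iff₀ (mul_pos hγlow hδ)] at hkbig
  linarith [hα k]
end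

section
/- If μ > 0, then min_{1≤j≤k} p_j ≤ ε̄ for every integer k ≥ 1 with k ≥ (1 + 1/(μ λ̲)) · log(1 + μ a_0 / ε̄), where log denotes the natural logarithm. (This is the outer-iteration complexity bound of Adaptive GPB in the strongly convex case, with p_k = φ(ŷ_k) − φ_*, a_k = ‖x̂_k − x_*‖², and a_0 = d_0² the squared distance from the initial point to the solution set.) -/
/-- A sequence that shrinks by more than a factor `θ` at each of its first `k ≥ 1` steps satisfies
`θ ^ k * b k < b 0`. -/
theorem pow_mul_lt_of_forall_mul_succ_lt {θ : ℝ} (hθ : 0 < θ) {b : ℕ → ℝ} {k : ℕ} (hk : 1 ≤ k)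
    (hb : ∀ j < k, θ * b (j + 1) < b j) : θ ^ k * b k < b 0 := by
  induction k, hk using Nat.le_induction with
  | base => simpa using hb 0 one_pos
  | succ n _ ih =>
    calc θ ^ (n + 1) * b (n + 1) = θ ^ n * (θ * b (n + 1)) := by ring
      _ < θ ^ n * b n := by gcongr; exact hb n n.lt_succ_self
      _ < b 0 := ih fun j hj => hb j (hj.trans n.lt_succ_self)

/-- If `(1 + 1 / x) * log y ≤ k` with `x > 0`, then `y ≤ (1 + x) ^ k`. -/
theorem le_one_add_pow_of_mul_log_le {x y : ℝ} (hx : 0 < x) (hy : 0 < y) {k : ℕ}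
    (h : (1 + 1 / x) * Real.log y ≤ k) : y ≤ (1 + x) ^ k := by
  have hlog : x / (1 + x) ≤ Real.log (1 + x) := by
    have := Real.one_sub_inv_le_log_of_pos (show 0 < 1 + x by positivity)
    convert this using 1
    field_simp
    ring
  rw [← Real.log_le_log_iff hy (by positivity), Real.log_pow]
  calc Real.log y = x / (1 + x) * ((1 + 1 / x) * Real.log y) := by field_simp; ring
    _ ≤ x / (1 + x) * k := by gcongr
    _ ≤ k * Real.log (1 + x) := by rw [mul_comm]; gcongr

/-- Theorem `thouter` of the paper, strongly convex case (μ > 0): if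
a_k ≥ 0, λ_k ≥ λ̲ > 0 and 2 λ_k p_k ≤ λ_k ε̄ + a_{k-1} - (1 + μ λ̲) a_k
for every k ≥ 1, then min_{1≤j≤k} p_j ≤ ε̄ for every integer k ≥ 1 with
k ≥ (1 + 1/(μ λ̲)) log(1 + μ a_0/ε̄). -/
theorem stmt_7 (εb lamL μ : ℝ) (a lam p : ℕ → ℝ)
    (hε : 0 < εb) (hlamL : 0 < lamL) (hμ : 0 < μ)
    (ha : ∀ k : ℕ, 0 ≤ a k)
    (hlam : ∀ k : ℕ, 1 ≤ k → lamL ≤ lam k)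
    (hrec : ∀ k : ℕ, 1 ≤ k →
      2 * lam k * p k ≤ lam k * εb + a (k - 1) - (1 + μ * lamL) * a k)
    (k : ℕ) (hk : 1 ≤ k)
    (hkbig : (1 + 1 / (μ * lamL)) * Real.log (1 + μ * a 0 / εb) ≤ (k : ℝ)) :
    (Finset.Icc 1 k).inf' (Finset.nonempty_Icc.mpr hk) p ≤ εb := by
  by_contra! hmin
  rw [Finset.lt_inf'_iff] at hmin
  have hθ : 0 < 1 + μ * lamL := by positivity
  have hstep : ∀ j < k, (1 + μ * lamL) * (μ * a (j + 1) + εb) < μ * a j + εb := by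
    intro j hj
    have hp := hmin (j + 1) (Finset.mem_Icc.mpr ⟨by omega, hj⟩)
    have hl := hlam (j + 1) (by omega)
    have hr := hrec (j + 1) (by omega)
    rw [Nat.add_sub_cancel] at hr
    have hlp : lam (j + 1) * εb < lam (j + 1) * p (j + 1) :=
      mul_lt_mul_of_pos_left hp (hlamL.trans_le hl)
    have hle : lamL * εb ≤ lam (j + 1) * εb := mul_le_mul_of_nonneg_right hl hε.le
    have ha' : lamL * εb + (1 + μ * lamL) * a (j + 1) < a j := by linarith
    linarith [mul_lt_mul_of_pos_left ha' hμ]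
  have hdecay := pow_mul_lt_of_forall_mul_succ_lt (b := fun j => μ * a j + εb) hθ hk hstep
  have hy : 0 < 1 + μ * a 0 / εb := by have := ha 0; positivity
  have hpow := le_one_add_pow_of_mul_log_le (mul_pos hμ hlamL) hy hkbig
  have hlower : μ * a 0 + εb ≤ (1 + μ * lamL) ^ k * (μ * a k + εb) :=
    calc μ * a 0 + εb = (1 + μ * a 0 / εb) * εb := by field_simp; ring
      _ ≤ (1 + μ * lamL) ^ k * (μ * a k + εb) := by
        gcongr
        linarith [mul_nonneg hμ.le (ha k)]
  exact hdecay.not_ge hlower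
end

section
/- min_{1≤j≤k} p_j ≤ ε̄ for every integer k ≥ 1 with k ≥ a_0 / (λ̲ ε̄). (This is the outer-iteration complexity bound of Adaptive GPB in the merely convex case, with p_k = φ(ŷ_k) − φ_*, a_k = ‖x̂_k − x_*‖², and a_0 = d_0² the squared distance from the initial point to the solution set.) -/
/-- A real sequence whose first `k ≥ 1` steps each decrease by more than `c` decreases by more
than `k * c` in total. -/
theorem add_nat_mul_lt_of_forall_add_lt {a : ℕ → ℝ} {c : ℝ} {k : ℕ} (hk : 1 ≤ k)
    (h : ∀ j < k, a (j + 1) + c < a j) : a k + k * c < a 0 := by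
  induction k, hk using Nat.le_induction with
  | base => simpa using h 0 one_pos
  | succ m hm ih =>
    have hlast := h m m.lt_succ_self
    have hprev := ih fun j hj => h j (hj.trans m.lt_succ_self)
    push_cast
    linarith

/-- Theorem `thouter` of the paper, merely convex case: if a_k ≥ 0,
λ_k ≥ λ̲ > 0, μ ≥ 0 and 2 λ_k p_k ≤ λ_k ε̄ + a_{k-1} - (1 + μ λ̲) a_k for
every k ≥ 1, then min_{1≤j≤k} p_j ≤ ε̄ for every integer k ≥ 1 with
k ≥ a_0/(λ̲ ε̄). -/
theorem stmt_8 (εb lamL μ : ℝ) (a lam p : ℕ → ℝ)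
    (hε : 0 < εb) (hlamL : 0 < lamL) (hμ : 0 ≤ μ)
    (ha : ∀ k : ℕ, 0 ≤ a k)
    (hlam : ∀ k : ℕ, 1 ≤ k → lamL ≤ lam k)
    (hrec : ∀ k : ℕ, 1 ≤ k →
      2 * lam k * p k ≤ lam k * εb + a (k - 1) - (1 + μ * lamL) * a k)
    (k : ℕ) (hk : 1 ≤ k)
    (hkbig : a 0 / (lamL * εb) ≤ (k : ℝ)) :
    (Finset.Icc 1 k).inf' (Finset.nonempty_Icc.mpr hk) p ≤ εb := by
  by_contra! hlt
  rw [Finset.lt_inf'_iff] at hlt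
  have hstep : ∀ j < k, a (j + 1) + lamL * εb < a j := by
    intro j hj
    have hp : εb < p (j + 1) := hlt (j + 1) (Finset.mem_Icc.mpr ⟨by omega, by omega⟩)
    have hl : lamL ≤ lam (j + 1) := hlam (j + 1) (by omega)
    have hr := hrec (j + 1) (by omega)
    rw [Nat.add_sub_cancel] at hr
    have hlp : lam (j + 1) * εb < lam (j + 1) * p (j + 1) :=
      mul_lt_mul_of_pos_left hp (hlamL.trans_le hl)
    have hle : lamL * εb ≤ lam (j + 1) * εb := mul_le_mul_of_nonneg_right hl hε.le
    have hμa : 0 ≤ μ * lamL * a (j + 1) := mul_nonneg (mul_nonneg hμ hlamL.le) (ha _)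
    linarith
  have htotal := add_nat_mul_lt_of_forall_add_lt hk hstep
  rw [div_le_iff₀ (mul_pos hlamL hε)] at hkbig
  linarith [ha k]
end
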